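/- Let η ∈ M(Q̃C) with η|_{C̃(T)} = evaluation at τ, Im τ > 0. Then the fiber M^η(QC) = {ξ ∈ M(QC) : ξ|_{Q̃C} = η} equals {ξ, ξ'} for a unique ξ ∈ M_τ(QC), where ξ'(q) = ξ(q̃) ∈ M_{τ̄}(QC). Consequently Ψ: ξ ↦ ξ|_{Q̃C} restricts to a bijection from M_τ(QC) onto M_τ(Q̃C). -/

import Mathlib

open MeasureTheory Real Filter Topology

noncomputable section

/-- The `n`-th Fourier coefficient of `f : ℝ → ℂ` (representing `x ↦ f(e^{ix})`). -/
def fourierCoef (f : ℝ → ℂ) (n : ℤ) : ℂ :=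
  (1 / (2 * π)) * ∫ x in (0 : ℝ)..(2 * π), f x * Complex.exp (-(Complex.I * n * x))

/-- `L^∞(T)`, modeled as bounded measurable `2π`-periodic functions `ℝ → ℂ`. -/
def LinfT : Set (ℝ → ℂ) :=
  {f | Function.Periodic f (2 * π) ∧ Measurable f ∧ ∃ C, ∀ x, ‖f x‖ ≤ C}

/-- `C(T)`: continuous `2π`-periodic functions. -/
def CtsT : Set (ℝ → ℂ) := {f | Function.Periodic f (2 * π) ∧ Continuous f}

/-- The Hardy space `H^∞`: bounded functions whose negative Fourier coefficients vanish. -/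
def HinfT : Set (ℝ → ℂ) := {f ∈ LinfT | ∀ n : ℤ, n < 0 → fourierCoef f n = 0}

/-- The conjugate Hardy space: bounded functions whose positive Fourier coefficients vanish. -/
def HinfBarT : Set (ℝ → ℂ) := {f ∈ LinfT | ∀ n : ℤ, 0 < n → fourierCoef f n = 0}

/-- The quasicontinuous functions `QC = (C + H^∞) ∩ (C + conj(H^∞))`. -/
def QCset : Set (ℝ → ℂ) :=
  {f | (∃ c ∈ CtsT, ∃ h ∈ HinfT, f = c + h) ∧ (∃ c ∈ CtsT, ∃ h ∈ HinfBarT, f = c + h)}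

/-- The flip `q̃(t) = q(1/t)`, i.e. `q̃(e^{ix}) = q(e^{-ix})`. -/
def flipF (f : ℝ → ℂ) : ℝ → ℂ := fun x => f (-x)

/-- The even quasicontinuous functions `Q̃C = {q ∈ QC : q = q̃}`. -/
def tQCset : Set (ℝ → ℂ) := {f ∈ QCset | flipF f = f}

/-- The even continuous functions `C̃(T)`. -/
def evContT : Set (ℝ → ℂ) := {f ∈ CtsT | flipF f = f}

/-- The piecewise continuous functions `PC`: `2π`-periodic functions having one-sided
limits at every point. -/
def PCset : Set (ℝ → ℂ) :=
  {p | Function.Periodic p (2 * π) ∧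
    ∀ θ : ℝ, (∃ l : ℂ, Tendsto p (𝓝[>] θ) (𝓝 l)) ∧ (∃ l : ℂ, Tendsto p (𝓝[<] θ) (𝓝 l))}

/-- `ξ` is a character (multiplicative linear functional of norm `1`) of the subalgebra of
`L^∞(T)` whose underlying set is `S`; only the values of `ξ` on `S` are relevant. -/
def IsChar (S : Set (ℝ → ℂ)) (ξ : (ℝ → ℂ) → ℂ) : Prop :=
  (∀ p ∈ S, ∀ q ∈ S, ξ (p + q) = ξ p + ξ q) ∧
  (∀ p ∈ S, ∀ q ∈ S, ξ (p * q) = ξ p * ξ q) ∧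
  (∀ (c : ℂ), ∀ q ∈ S, ξ (c • q) = c * ξ q) ∧
  ξ 1 = 1 ∧
  (∀ q ∈ S, ∀ C : ℝ, (∀ x, ‖q x‖ ≤ C) → ‖ξ q‖ ≤ C)

/-- The moving average `δ_{λ,τ}(a) = (λ/2π) ∫_{θ-π/λ}^{θ+π/λ} a(e^{ix}) dx`, `τ = e^{iθ}`. -/
def movAvg (a : ℝ → ℂ) (lam θ : ℝ) : ℂ :=
  (lam / (2 * π)) * ∫ x in (θ - π / lam)..(θ + π / lam), a x

/-- `ξ ∈ M_τ^0(S)` (`τ = e^{iθ}`): `ξ` is a character of (the algebra with underlying set) `S`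
lying in the weak-* closure of the moving-average functionals `{δ_{λ,τ} : λ ∈ [1,∞)}`. -/
def InM0 (S : Set (ℝ → ℂ)) (θ : ℝ) (ξ : (ℝ → ℂ) → ℂ) : Prop :=
  IsChar S ξ ∧
  ∀ qs : List (ℝ → ℂ), (∀ q ∈ qs, q ∈ S) → ∀ ε : ℝ, 0 < ε →
    ∃ lam : ℝ, 1 ≤ lam ∧ ∀ q ∈ qs, ‖ξ q - movAvg q lam θ‖ < ε

/-- `ξ ∈ M_τ(S)` (`τ = e^{iθ}`): the fiber condition `ξ(f) = f(τ)` for all continuous `f`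
belonging to `S`. -/
def InFiber (S : Set (ℝ → ℂ)) (θ : ℝ) (ξ : (ℝ → ℂ) → ℂ) : Prop :=
  IsChar S ξ ∧ ∀ f ∈ CtsT ∩ S, ξ f = f θ

/-- `ξ ∈ M_τ^+(QC)`: `ξ(f) = 0` whenever `limsup_{t→τ+0}|f(t)| = 0`, `f ∈ QC`. -/
def InMplus (θ : ℝ) (ξ : (ℝ → ℂ) → ℂ) : Prop :=
  IsChar QCset ξ ∧
  ∀ f ∈ QCset, Filter.limsup (fun x => ‖f x‖) (𝓝[>] θ) = 0 → ξ f = 0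

/-- `ξ ∈ M_τ^-(QC)`: `ξ(f) = 0` whenever `limsup_{t→τ-0}|f(t)| = 0`, `f ∈ QC`. -/
def InMminus (θ : ℝ) (ξ : (ℝ → ℂ) → ℂ) : Prop :=
  IsChar QCset ξ ∧
  ∀ f ∈ QCset, Filter.limsup (fun x => ‖f x‖) (𝓝[<] θ) = 0 → ξ f = 0

/-- The conjugate character `ξ'(q) = ξ(q̃)`. -/
def conjChar (ξ : (ℝ → ℂ) → ℂ) : (ℝ → ℂ) → ℂ := fun q => ξ (flipF q)

/-! ### Abstract algebra part -/

/-- Closure properties of the function algebra used below. -/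
structure QCAlg : Prop where
  add : ∀ p ∈ QCset, ∀ q ∈ QCset, p + q ∈ QCset
  mul : ∀ p ∈ QCset, ∀ q ∈ QCset, p * q ∈ QCset
  smul : ∀ (c : ℂ), ∀ q ∈ QCset, c • q ∈ QCset
  flip : ∀ q ∈ QCset, flipF q ∈ QCset
  cts : ∀ q ∈ CtsT, q ∈ QCset

def sinF : ℝ → ℂ := fun x => (Real.sin x : ℂ)

def evP (q : ℝ → ℂ) : ℝ → ℂ := (1 / 2 : ℂ) • (q + flipF q)
def odP (q : ℝ → ℂ) : ℝ → ℂ := (1 / 2 : ℂ) • (q + (-1 : ℂ) • flipF q)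

lemma sinF_cts : sinF ∈ CtsT := by
  refine ⟨fun x => ?_, ?_⟩
  · simp only [sinF, Real.sin_add_two_pi]
  · unfold sinF; fun_prop

lemma ev_add_od (q : ℝ → ℂ) : evP q + odP q = q := by
  funext x; simp [evP, odP]; ring

lemma flip_cts {q : ℝ → ℂ} (h : q ∈ CtsT) : flipF q ∈ CtsT := by
  refine ⟨fun x => ?_, ?_⟩
  · have := h.1 (-(x + 2 * π))
    simp only [flipF]
    rw [← this]; congr 1; ring
  · exact h.2.comp continuous_neg

lemma one_cts : (1 : ℝ → ℂ) ∈ CtsT := ⟨fun _ => rfl, continuous_const⟩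


lemma evP_mem (A : QCAlg) {q : ℝ → ℂ} (h : q ∈ QCset) : evP q ∈ tQCset := by
  refine ⟨A.smul _ _ (A.add _ h _ (A.flip _ h)), ?_⟩
  funext x; simp [evP, flipF]; ring

lemma odP_mem (A : QCAlg) {q : ℝ → ℂ} (h : q ∈ QCset) : odP q ∈ QCset :=
  A.smul _ _ (A.add _ h _ (A.smul _ _ (A.flip _ h)))

lemma odS_mem (A : QCAlg) {q : ℝ → ℂ} (h : q ∈ QCset) : odP q * sinF ∈ tQCset := by
  refine ⟨A.mul _ (odP_mem A h) _ (A.cts _ sinF_cts), ?_⟩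
  funext x; simp [odP, flipF, sinF]; ring

lemma tadd (A : QCAlg) {p q : ℝ → ℂ} (hp : p ∈ tQCset) (hq : q ∈ tQCset) : p + q ∈ tQCset :=
  ⟨A.add _ hp.1 _ hq.1, by
    have h1 := hp.2; have h2 := hq.2
    conv_rhs => rw [← h1, ← h2]
    rfl⟩

lemma tmul (A : QCAlg) {p q : ℝ → ℂ} (hp : p ∈ tQCset) (hq : q ∈ tQCset) : p * q ∈ tQCset :=
  ⟨A.mul _ hp.1 _ hq.1, by
    have h1 := hp.2; have h2 := hq.2
    conv_rhs => rw [← h1, ← h2]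
    rfl⟩

lemma tsmul (A : QCAlg) {p : ℝ → ℂ} (c : ℂ) (hp : p ∈ tQCset) : c • p ∈ tQCset :=
  ⟨A.smul _ _ hp.1, by
    have h1 := hp.2
    conv_rhs => rw [← h1]
    rfl⟩

lemma odod_mem (A : QCAlg) {p q : ℝ → ℂ} (hp : p ∈ QCset) (hq : q ∈ QCset) : odP p * odP q ∈ tQCset := by
  refine ⟨A.mul _ (odP_mem A hp) _ (odP_mem A hq), ?_⟩
  funext x; simp [odP, flipF]; ring

/-- Power trick: a multiplicative functional that is bounded is contractive. -/
lemma le_of_pow_bound {a C K : ℝ} (hC : 0 ≤ C)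
    (h : ∀ n : ℕ, a ^ (n + 1) ≤ K * C ^ (n + 1)) : a ≤ C := by
  by_contra hlt
  push Not at hlt
  rcases hC.eq_or_lt with h0 | h0
  · have := h 0
    rw [← h0] at this hlt
    simp at this
    linarith
  · have hr : 1 < a / C := by rwa [one_lt_div h0]
    obtain ⟨n, hn⟩ := pow_unbounded_of_one_lt K hr
    have h1 : (a / C) ^ n ≤ (a / C) ^ (n + 1) := pow_le_pow_right₀ hr.le (Nat.le_succ n)
    have h2 : (a / C) ^ (n + 1) ≤ K := by
      rw [div_pow, div_le_iff₀ (by positivity)]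
      exact h n
    linarith

def extC (θ : ℝ) (η : (ℝ → ℂ) → ℂ) : (ℝ → ℂ) → ℂ :=
  fun q => η (evP q) + η (odP q * sinF) / (Real.sin θ : ℂ)

lemma ext_isChar (A : QCAlg) {θ : ℝ} (hs : 0 < Real.sin θ) {η : (ℝ → ℂ) → ℂ} (hη : IsChar tQCset η)
    (hfib : ∀ f ∈ evContT, η f = f θ) : IsChar QCset (extC θ η) := by
  obtain ⟨ha, hm, hsm, h1, hb⟩ := hη
  have hs0 : (Real.sin θ : ℂ) ≠ 0 := by exact_mod_cast hs.ne'
  have hsin2 : sinF * sinF ∈ evContT := by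
    refine ⟨⟨fun x => ?_, sinF_cts.2.mul sinF_cts.2⟩, ?_⟩
    · simp [sinF, Real.sin_add_two_pi]
    · funext x; simp [flipF, sinF]
  have hsin2t : sinF * sinF ∈ tQCset := ⟨A.cts _ hsin2.1, hsin2.2⟩
  have hsin2v : η (sinF * sinF) = (Real.sin θ : ℂ) * Real.sin θ := by
    rw [hfib _ hsin2]; rfl
  have mulX : ∀ p ∈ QCset, ∀ q ∈ QCset, extC θ η (p * q) = extC θ η p * extC θ η q := by
    intro p hp q hq
    have e1 : evP (p * q) = evP p * evP q + odP p * odP q := by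
      funext x; simp [evP, odP, flipF]; ring
    have e2 : odP (p * q) * sinF = evP p * (odP q * sinF) + evP q * (odP p * sinF) := by
      funext x; simp [evP, odP, flipF]; ring
    have e3 : η (odP p * odP q) * ((Real.sin θ : ℂ) * Real.sin θ)
        = η (odP p * sinF) * η (odP q * sinF) := by
      rw [← hsin2v, ← hm _ (odod_mem A hp hq) _ hsin2t, ← hm _ (odS_mem A hp) _ (odS_mem A hq)]
      congr 1; ring
    have e4 : η (odP p * odP q) = η (odP p * sinF) * η (odP q * sinF) /
        ((Real.sin θ : ℂ) * Real.sin θ) := by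
      rw [← e3]; field_simp
    simp only [extC]
    rw [e1, e2, ha _ (tmul A (evP_mem A hp) (evP_mem A hq)) _ (odod_mem A hp hq),
      ha _ (tmul A (evP_mem A hp) (odS_mem A hq)) _ (tmul A (evP_mem A hq) (odS_mem A hp)),
      hm _ (evP_mem A hp) _ (evP_mem A hq), hm _ (evP_mem A hp) _ (odS_mem A hq),
      hm _ (evP_mem A hq) _ (odS_mem A hp), e4]
    field_simp
    ring
  have one1 : extC θ η 1 = 1 := by
    have e1 : evP 1 = 1 := by funext x; simp [evP, flipF]; norm_num
    have e2 : odP 1 * sinF = (0 : ℂ) • (1 : ℝ → ℂ) := by funext x; simp [odP, flipF]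
    have : (1 : ℝ → ℂ) ∈ tQCset := ⟨A.cts _ one_cts, rfl⟩
    simp only [extC]
    rw [e1, e2, hsm _ _ this, h1]; simp
  have bd : ∀ q ∈ QCset, ∀ C : ℝ, (∀ x, ‖q x‖ ≤ C) →
      ‖extC θ η q‖ ≤ (1 + 1 / Real.sin θ) * C := by
    intro q hq C hC
    have b1 : ‖η (evP q)‖ ≤ C := by
      refine hb _ (evP_mem A hq) C fun x => ?_
      have := norm_add_le (q x) (q (-x))
      have h1 := hC x; have h2 := hC (-x)
      simp only [evP, flipF, Pi.smul_apply, Pi.add_apply, smul_eq_mul, norm_mul]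
      norm_num
      linarith
    have b2 : ‖η (odP q * sinF)‖ ≤ C := by
      refine hb _ (odS_mem A hq) C fun x => ?_
      have := norm_sub_le (q x) (q (-x))
      have h1 := hC x; have h2 := hC (-x)
      have h3 : ‖odP q x‖ ≤ C := by
        simp only [odP, flipF, Pi.smul_apply, Pi.add_apply, smul_eq_mul, norm_mul]
        norm_num [← sub_eq_add_neg]
        linarith
      have h4 : ‖sinF x‖ ≤ 1 := by
        simp only [sinF, Complex.norm_real]
        exact Real.abs_sin_le_one x
      simp only [Pi.mul_apply, norm_mul]
      have h5 := mul_le_mul h3 h4 (norm_nonneg _) ((norm_nonneg _).trans h3)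
      linarith
    calc ‖extC θ η q‖ ≤ ‖η (evP q)‖ + ‖η (odP q * sinF) / (Real.sin θ : ℂ)‖ := norm_add_le _ _
      _ = ‖η (evP q)‖ + ‖η (odP q * sinF)‖ / Real.sin θ := by
        rw [norm_div, Complex.norm_real, Real.norm_of_nonneg hs.le]
      _ ≤ C + C / Real.sin θ := by gcongr
      _ = _ := by ring
  refine ⟨?_, mulX, ?_, one1, ?_⟩
  · intro p hp q hq
    have e1 : evP (p + q) = evP p + evP q := by
      funext x; simp [evP, flipF]; ring
    have e2 : odP (p + q) * sinF = odP p * sinF + odP q * sinF := by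
      funext x; simp [odP, flipF]; ring
    simp only [extC]
    rw [e1, e2, ha _ (evP_mem A hp) _ (evP_mem A hq), ha _ (odS_mem A hp) _ (odS_mem A hq)]
    ring
  · intro c q hq
    have e1 : evP (c • q) = c • evP q := by
      funext x; simp [evP, flipF]; ring
    have e2 : odP (c • q) * sinF = c • (odP q * sinF) := by
      funext x; simp [odP, flipF]; ring
    simp only [extC]
    rw [e1, e2, hsm _ _ (evP_mem A hq), hsm _ _ (odS_mem A hq)]
    ring
  · intro q hq C hC
    have powX : ∀ n : ℕ, q ^ (n + 1) ∈ QCset ∧ extC θ η (q ^ (n + 1)) = extC θ η q ^ (n + 1) := by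
      intro n
      induction n with
      | zero => simpa using hq
      | succ n ih =>
        rw [pow_succ q (n + 1), pow_succ _ (n + 1)]
        exact ⟨A.mul _ ih.1 _ hq, by rw [mulX _ ih.1 _ hq, ih.2]⟩
    refine le_of_pow_bound (K := 1 + 1 / Real.sin θ)
      ((norm_nonneg _).trans (hC 0)) fun n => ?_
    rw [← norm_pow, ← (powX n).2]
    refine bd _ (powX n).1 _ fun x => ?_
    simp only [Pi.pow_apply, norm_pow]
    exact pow_le_pow_left₀ (norm_nonneg _) (hC x) _

lemma ext_even {θ : ℝ} {η : (ℝ → ℂ) → ℂ} (hη : IsChar tQCset η) {q : ℝ → ℂ}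
    (hq : q ∈ tQCset) : extC θ η q = η q := by
  have e1 : evP q = q := by
    funext x
    have := congrFun hq.2 x
    simp [evP, this]; ring
  have e2 : odP q * sinF = (0 : ℂ) • q := by
    funext x
    have := congrFun hq.2 x
    simp [odP, this]
  simp only [extC]
  rw [e1, e2, hη.2.2.1 _ _ hq]; simp

lemma ext_cts {θ : ℝ} (hs : 0 < Real.sin θ) {η : (ℝ → ℂ) → ℂ}
    (hfib : ∀ f ∈ evContT, η f = f θ) {f : ℝ → ℂ} (hf : f ∈ CtsT) : extC θ η f = f θ := by
  have hs0 : (Real.sin θ : ℂ) ≠ 0 := by exact_mod_cast hs.ne'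
  have hf' := flip_cts hf
  have m1 : evP f ∈ evContT := by
    refine ⟨⟨fun x => ?_, (hf.2.add hf'.2).const_smul _⟩, ?_⟩
    · have h1 := hf.1 x; have h2 := hf'.1 x
      simp [evP, h1, h2]
    · funext x; simp [evP, flipF]; ring
  have m2 : odP f * sinF ∈ evContT := by
    refine ⟨⟨fun x => ?_, ((hf.2.add (hf'.2.const_smul _)).const_smul _).mul sinF_cts.2⟩, ?_⟩
    · have h1 := hf.1 x; have h2 := hf'.1 x; have h3 := sinF_cts.1 x
      simp [odP, h1, h2, h3]
    · funext x; simp [odP, flipF, sinF]; ring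
  simp only [extC]
  rw [hfib _ m1, hfib _ m2]
  have : (odP f * sinF) θ = odP f θ * (Real.sin θ : ℂ) := rfl
  rw [this, mul_div_cancel_right₀ _ hs0]
  exact congrFun (ev_add_od f) θ

/-- If `ζ` is a character with `ζ(sin) = s ≠ 0`, it is determined by its even restriction. -/
lemma char_formula (A : QCAlg) {ζ : (ℝ → ℂ) → ℂ} (hζ : IsChar QCset ζ) {s : ℂ} (hs : s ≠ 0)
    (hsin : ζ sinF = s) {q : ℝ → ℂ} (hq : q ∈ QCset) :
    ζ q = ζ (evP q) + ζ (odP q * sinF) / s := by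
  rw [hζ.2.1 _ (odP_mem A hq) _ (A.cts _ sinF_cts), hsin, mul_div_cancel_right₀ _ hs,
    ← hζ.1 _ (evP_mem A hq).1 _ (odP_mem A hq), ev_add_od]

lemma conj_isChar (A : QCAlg) {ξ : (ℝ → ℂ) → ℂ} (hξ : IsChar QCset ξ) : IsChar QCset (conjChar ξ) := by
  obtain ⟨h1, h2, h3, h4, h5⟩ := hξ
  refine ⟨fun p hp q hq => h1 _ (A.flip _ hp) _ (A.flip _ hq),
    fun p hp q hq => h2 _ (A.flip _ hp) _ (A.flip _ hq), fun c q hq => h3 c _ (A.flip _ hq), h4,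
    fun q hq C hC => h5 _ (A.flip _ hq) C fun x => hC (-x)⟩

lemma inj_part (A : QCAlg) {θ : ℝ} (hs : 0 < Real.sin θ) (ξ₁ ξ₂ : (ℝ → ℂ) → ℂ)
    (h1 : InFiber QCset θ ξ₁) (h2 : InFiber QCset θ ξ₂)
    (h : ∀ q ∈ tQCset, ξ₁ q = ξ₂ q) : ∀ q ∈ QCset, ξ₁ q = ξ₂ q := by
  intro q hq
  have hs0 : (Real.sin θ : ℂ) ≠ 0 := by exact_mod_cast hs.ne'
  rw [char_formula A h1.1 hs0 (h1.2 _ ⟨sinF_cts, A.cts _ sinF_cts⟩) hq,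
    char_formula A h2.1 hs0 (h2.2 _ ⟨sinF_cts, A.cts _ sinF_cts⟩) hq,
    h _ (evP_mem A hq), h _ (odS_mem A hq)]

lemma surj_part (A : QCAlg) {θ : ℝ} (hs : 0 < Real.sin θ) {η : (ℝ → ℂ) → ℂ} (hη : IsChar tQCset η)
    (hfib : ∀ f ∈ evContT, η f = f θ) :
    InFiber QCset θ (extC θ η) ∧ ∀ q ∈ tQCset, extC θ η q = η q :=
  ⟨⟨ext_isChar A hs hη hfib, fun _ hf => ext_cts hs hfib hf.1⟩, fun _ hq => ext_even hη hq⟩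

lemma fiber_part (A : QCAlg) {θ : ℝ} (hs : 0 < Real.sin θ) {η : (ℝ → ℂ) → ℂ}
    (hfib : ∀ f ∈ evContT, η f = f θ) (ζ : (ℝ → ℂ) → ℂ) (hζ : IsChar QCset ζ)
    (h : ∀ q ∈ tQCset, ζ q = η q) :
    (∀ q ∈ QCset, ζ q = extC θ η q) ∨ (∀ q ∈ QCset, ζ q = conjChar (extC θ η) q) := by
  have hs0 : (Real.sin θ : ℂ) ≠ 0 := by exact_mod_cast hs.ne'
  have hsin2 : sinF * sinF ∈ evContT := by
    refine ⟨⟨fun x => ?_, sinF_cts.2.mul sinF_cts.2⟩, ?_⟩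
    · simp [sinF, Real.sin_add_two_pi]
    · funext x; simp [flipF, sinF]
  have hsq : ζ sinF * ζ sinF = (Real.sin θ : ℂ) * Real.sin θ := by
    rw [← hζ.2.1 _ (A.cts _ sinF_cts) _ (A.cts _ sinF_cts), h _ ⟨A.cts _ hsin2.1, hsin2.2⟩,
      hfib _ hsin2]; rfl
  rcases mul_self_eq_mul_self_iff.1 hsq with hv | hv
  · left
    intro q hq
    rw [char_formula A hζ hs0 hv hq, h _ (evP_mem A hq), h _ (odS_mem A hq)]; rfl
  · right
    intro q hq
    rw [char_formula A hζ (neg_ne_zero.2 hs0) hv hq, h _ (evP_mem A hq)]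
    have e1 : evP (flipF q) = evP q := by
      funext x; simp [evP, flipF]; ring
    have e2 : odP q * sinF = (-1 : ℂ) • (odP (flipF q) * sinF) := by
      funext x; simp [odP, flipF]; ring
    have e3 : ζ (odP q * sinF) = - η (odP (flipF q) * sinF) := by
      rw [e2, hζ.2.2.1 _ _ (odS_mem A (A.flip _ hq)).1, h _ (odS_mem A (A.flip _ hq))]; ring
    simp only [conjChar, extC]
    rw [e1, e3, neg_div_neg_eq]

/-! ### Fourier analysis part -/

instance factTwoPi : Fact (0 < 2 * π) := ⟨Real.two_pi_pos⟩

lemma linf_add {f g : ℝ → ℂ} (hf : f ∈ LinfT) (hg : g ∈ LinfT) : f + g ∈ LinfT := by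
  obtain ⟨p1, m1, C1, h1⟩ := hf
  obtain ⟨p2, m2, C2, h2⟩ := hg
  exact ⟨p1.add p2, m1.add m2, C1 + C2, fun x => (norm_add_le _ _).trans (add_le_add (h1 x) (h2 x))⟩

lemma linf_smul (c : ℂ) {f : ℝ → ℂ} (hf : f ∈ LinfT) : c • f ∈ LinfT := by
  obtain ⟨p1, m1, C1, h1⟩ := hf
  refine ⟨p1.smul c, m1.const_smul c, ‖c‖ * C1, fun x => ?_⟩
  simp only [Pi.smul_apply, norm_smul]
  exact mul_le_mul_of_nonneg_left (h1 x) (norm_nonneg _)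

lemma linf_sub {f g : ℝ → ℂ} (hf : f ∈ LinfT) (hg : g ∈ LinfT) : f - g ∈ LinfT := by
  have := linf_add hf (linf_smul (-1) hg)
  simpa [sub_eq_add_neg] using this

lemma linf_mul {f g : ℝ → ℂ} (hf : f ∈ LinfT) (hg : g ∈ LinfT) : f * g ∈ LinfT := by
  obtain ⟨p1, m1, C1, h1⟩ := hf
  obtain ⟨p2, m2, C2, h2⟩ := hg
  refine ⟨p1.mul p2, m1.mul m2, C1 * C2, fun x => ?_⟩
  simp only [Pi.mul_apply, norm_mul]
  exact mul_le_mul (h1 x) (h2 x) (norm_nonneg _) ((norm_nonneg _).trans (h1 x))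

lemma linf_flip {f : ℝ → ℂ} (hf : f ∈ LinfT) : flipF f ∈ LinfT := by
  obtain ⟨p1, m1, C1, h1⟩ := hf
  refine ⟨fun x => ?_, m1.comp measurable_neg, C1, fun x => h1 (-x)⟩
  have := p1 (-(x + 2 * π))
  simp only [flipF]
  rw [← this]; congr 1; ring

lemma cts_linf {f : ℝ → ℂ} (hf : f ∈ CtsT) : f ∈ LinfT := by
  refine ⟨hf.1, hf.2.measurable, ?_⟩
  obtain ⟨C, hC⟩ := (isCompact_Icc (a := (0 : ℝ)) (b := 2 * π)).exists_bound_of_continuousOn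
    hf.2.continuousOn
  refine ⟨C, fun x => ?_⟩
  obtain ⟨y, hy, hxy⟩ := hf.1.exists_mem_Ico₀ Real.two_pi_pos x
  rw [hxy]
  exact hC y ⟨hy.1, hy.2.le⟩

lemma linf_ii {f : ℝ → ℂ} (hf : f ∈ LinfT) (a b : ℝ) : IntervalIntegrable f volume a b := by
  obtain ⟨p1, m1, C1, h1⟩ := hf
  have : IntervalIntegrable (fun _ : ℝ => C1) volume a b := intervalIntegrable_const
  exact this.mono_fun m1.aestronglyMeasurable
    (Eventually.of_forall fun x => (h1 x).trans (le_abs_self _))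

/-- The exponential `e^{ikx}`. -/
def ex (k : ℤ) : ℝ → ℂ := fun x => Complex.exp (Complex.I * k * x)

lemma ex_eq_fourier (k : ℤ) (x : ℝ) : ex k x = fourier k (x : AddCircle (2 * π)) := by
  rw [fourier_coe_apply, ex]
  congr 1
  have : (π : ℂ) ≠ 0 := by exact_mod_cast Real.pi_ne_zero
  push_cast
  field_simp

lemma ex_cts (k : ℤ) : ex k ∈ CtsT := by
  refine ⟨fun x => ?_, by unfold ex; fun_prop⟩
  rw [ex_eq_fourier, ex_eq_fourier, AddCircle.coe_add_period]

lemma ex_norm (k : ℤ) (x : ℝ) : ‖ex k x‖ = 1 := by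
  have : Complex.I * k * x = ((k * x : ℝ) : ℂ) * Complex.I := by push_cast; ring
  rw [ex, this, Complex.norm_exp_ofReal_mul_I]

lemma ex_add (j k : ℤ) (x : ℝ) : ex (j + k) x = ex j x * ex k x := by
  rw [ex, ex, ex, ← Complex.exp_add]; congr 1; push_cast; ring

lemma ex_neg_arg (k : ℤ) (x : ℝ) : ex k (-x) = ex (-k) x := by
  simp [ex]

lemma ex_sub_arg (k : ℤ) (x y : ℝ) : ex k (x - y) = ex k x * ex (-k) y := by
  rw [ex, ex, ex, ← Complex.exp_add]; congr 1; push_cast; ring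

lemma ex_conj (k : ℤ) (x : ℝ) : (starRingEnd ℂ) (ex k x) = ex (-k) x := by
  rw [ex_eq_fourier, ex_eq_fourier, fourier_neg]

lemma coef_def (f : ℝ → ℂ) (n : ℤ) :
    fourierCoef f n = (1 / (2 * π)) * ∫ x in (0 : ℝ)..(2 * π), (f * ex (-n)) x := by
  rw [fourierCoef]
  congr 2
  funext x
  simp [ex]

lemma coef_eq_lift {f : ℝ → ℂ} (hf : Function.Periodic f (2 * π)) (n : ℤ) :
    fourierCoef f n = fourierCoeff (hf.lift : AddCircle (2 * π) → ℂ) n := by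
  rw [fourierCoeff_eq_intervalIntegral _ n 0, coef_def, zero_add]
  have : ∀ x : ℝ, fourier (-n) (x : AddCircle (2 * π)) • (hf.lift : AddCircle (2 * π) → ℂ) x
      = (f * ex (-n)) x := by
    intro x
    rw [hf.lift_coe, ← ex_eq_fourier, smul_eq_mul, mul_comm]; rfl
  simp_rw [this]
  rw [Complex.real_smul]
  push_cast
  rfl

lemma coef_add {f g : ℝ → ℂ} (hf : f ∈ LinfT) (hg : g ∈ LinfT) (n : ℤ) :
    fourierCoef (f + g) n = fourierCoef f n + fourierCoef g n := by
  rw [coef_def, coef_def, coef_def, add_mul, ← mul_add]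
  congr 1
  exact intervalIntegral.integral_add (linf_ii (linf_mul hf (cts_linf (ex_cts _))) _ _)
    (linf_ii (linf_mul hg (cts_linf (ex_cts _))) _ _)

lemma coef_smul (c : ℂ) (f : ℝ → ℂ) (n : ℤ) :
    fourierCoef (c • f) n = c * fourierCoef f n := by
  rw [coef_def, coef_def, smul_mul_assoc]
  simp only [Pi.smul_apply, smul_eq_mul]
  rw [intervalIntegral.integral_const_mul]; ring

lemma coef_sub {f g : ℝ → ℂ} (hf : f ∈ LinfT) (hg : g ∈ LinfT) (n : ℤ) :
    fourierCoef (f - g) n = fourierCoef f n - fourierCoef g n := by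
  have : f - g = f + (-1 : ℂ) • g := by simp [sub_eq_add_neg]
  rw [this, coef_add hf (linf_smul _ hg), coef_smul]; ring

lemma coef_norm_le {f : ℝ → ℂ} {C : ℝ} (h : ∀ x, ‖f x‖ ≤ C) (n : ℤ) :
    ‖fourierCoef f n‖ ≤ C := by
  have h1 : ‖∫ x in (0 : ℝ)..(2 * π), (f * ex (-n)) x‖ ≤ C * |2 * π - 0| := by
    apply intervalIntegral.norm_integral_le_of_norm_le_const
    intro x _
    simp only [Pi.mul_apply, norm_mul, ex_norm, mul_one]
    exact h x
  rw [sub_zero, abs_of_pos Real.two_pi_pos] at h1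
  rw [coef_def, norm_mul]
  have h2 : ‖(1 / (2 * π) : ℂ)‖ = 1 / (2 * π) := by
    rw [show (1 / (2 * π) : ℂ) = ((1 / (2 * π) : ℝ) : ℂ) by push_cast; rfl, Complex.norm_real,
      Real.norm_of_nonneg (by positivity)]
  rw [h2]
  calc 1 / (2 * π) * _ ≤ 1 / (2 * π) * (C * (2 * π)) := by gcongr
    _ = C := by field_simp

lemma coef_flip {f : ℝ → ℂ} (hf : f ∈ LinfT) (n : ℤ) :
    fourierCoef (flipF f) n = fourierCoef f (-n) := by
  rw [coef_def, coef_def]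
  congr 1
  have h1 : ∀ x, (flipF f * ex (-n)) x = (f * ex (- -n)) (-x) := by
    intro x
    simp only [Pi.mul_apply, flipF, ex_neg_arg, neg_neg]
  simp_rw [h1]
  rw [intervalIntegral.integral_comp_neg (fun x => (f * ex (- -n)) x)]
  have hp := (linf_mul hf (cts_linf (ex_cts (- -n)))).1
  have := hp.intervalIntegral_add_eq (-(2 * π)) 0
  simpa using this

lemma coef_ex (k m : ℤ) : fourierCoef (ex k) m = if m = k then 1 else 0 := by
  rw [coef_eq_lift (ex_cts k).1]
  have : ((ex_cts k).1.lift : AddCircle (2 * π) → ℂ) = fourier k := by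
    funext y
    induction y using QuotientAddGroup.induction_on with
    | H x => exact ((ex_cts k).1.lift_coe x).trans (ex_eq_fourier k x)
  rw [this, fourierCoeff_fourier, Pi.single_apply]

/-- The lift to the circle of a bounded measurable function is in `L²`. -/
lemma lift_memLp {f : ℝ → ℂ} (hf : f ∈ LinfT) :
    MemLp (hf.1.lift : AddCircle (2 * π) → ℂ) 2 AddCircle.haarAddCircle := by
  have e : (hf.1.lift : AddCircle (2 * π) → ℂ) =
      fun y => f (AddCircle.measurableEquivIoc (2 * π) 0 y) := by
    funext y
    rw [← hf.1.lift_coe]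
    congr 1
    exact (AddCircle.coe_equivIoc (p := 2 * π) (a := 0)).symm
  obtain ⟨C, hC⟩ := hf.2.2
  refine MemLp.of_bound (Measurable.aestronglyMeasurable ?_) C (Eventually.of_forall fun y => ?_)
  · rw [e]
    exact hf.2.1.comp (measurable_subtype_coe.comp (MeasurableEquiv.measurable _))
  · rw [e]; exact hC _

/-- Convolution theorem in the only form needed: if all products `f̂(m-k) ĝ(k)` vanish then the
`m`-th coefficient of `f g` vanishes. -/
lemma coef_mul_zero {f g : ℝ → ℂ} (hf : f ∈ LinfT) (hg : g ∈ LinfT) (m : ℤ)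
    (h : ∀ k, fourierCoef f (m - k) * fourierCoef g k = 0) : fourierCoef (f * g) m = 0 := by
  -- `F = conj (f) e^{imx}`
  have hF : (fun x => (starRingEnd ℂ) (f x) * ex m x) ∈ LinfT := by
    refine linf_mul (f := fun x => (starRingEnd ℂ) (f x)) ?_ (cts_linf (ex_cts m))
    obtain ⟨p1, m1, C1, h1⟩ := hf
    refine ⟨fun x => by simp only [p1 x], Complex.continuous_conj.measurable.comp m1, C1,
      fun x => by simpa using h1 x⟩
  set F : ℝ → ℂ := fun x => (starRingEnd ℂ) (f x) * ex m x with hFdef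
  have hFc : ∀ k, fourierCoef F k = (starRingEnd ℂ) (fourierCoef f (m - k)) := by
    intro k
    rw [coef_def, coef_def, map_mul, intervalIntegral.integral_of_le Real.two_pi_pos.le,
      intervalIntegral.integral_of_le Real.two_pi_pos.le, ← integral_conj]
    congr 1
    · simp [Complex.conj_ofNat]
    · congr 1
      funext x
      simp only [Pi.mul_apply, hFdef, map_mul, ex_conj]
      rw [mul_assoc, ← ex_add]
      congr 2; ring
  set Fl := (lift_memLp hF).toLp
  set Gl := (lift_memLp hg).toLp
  have key := (fourierBasis (T := 2 * π)).hasSum_inner_mul_inner Fl Gl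
  have hFr : ∀ k, inner ℂ (fourierBasis (T := 2 * π) k) Fl = fourierCoef F k := by
    intro k
    rw [← HilbertBasis.repr_apply_apply, fourierBasis_repr, coef_eq_lift hF.1]
    exact congrFun (fourierCoeff_congr_ae (lift_memLp hF).coeFn_toLp) k
  have hGr : ∀ k, inner ℂ (fourierBasis (T := 2 * π) k) Gl = fourierCoef g k := by
    intro k
    rw [← HilbertBasis.repr_apply_apply, fourierBasis_repr, coef_eq_lift hg.1]
    exact congrFun (fourierCoeff_congr_ae (lift_memLp hg).coeFn_toLp) k
  have hz : ∀ k, inner ℂ Fl (fourierBasis (T := 2 * π) k) *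
      inner ℂ (fourierBasis (T := 2 * π) k) Gl = 0 := by
    intro k
    rw [← inner_conj_symm, hFr, hGr, hFc, Complex.conj_conj, h]
  simp_rw [hz] at key
  have h0 : inner ℂ Fl Gl = (0 : ℂ) := key.unique hasSum_zero
  rw [MeasureTheory.L2.inner_def] at h0
  rw [coef_eq_lift (linf_mul hf hg).1, fourierCoeff, ← h0]
  refine integral_congr_ae ?_
  filter_upwards [(lift_memLp hF).coeFn_toLp, (lift_memLp hg).coeFn_toLp] with y h1 h2
  simp only [Fl, Gl]
  rw [h1, h2]
  induction y using QuotientAddGroup.induction_on with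
  | H x =>
    have a1 := (linf_mul hf hg).1.lift_coe x
    have a2 := hF.1.lift_coe x
    have a3 := hg.1.lift_coe x
    have a4 := ex_eq_fourier (-m) x
    erw [a1, a2, a3, ← a4]
    simp only [RCLike.inner_apply', smul_eq_mul, hFdef, Pi.mul_apply, map_mul, ex_conj,
      Complex.conj_conj]
    ring

/-! ### A de la Vallée-Poussin type kernel -/

lemma cts_add {f g : ℝ → ℂ} (hf : f ∈ CtsT) (hg : g ∈ CtsT) : f + g ∈ CtsT :=
  ⟨hf.1.add hg.1, hf.2.add hg.2⟩

lemma cts_smul (c : ℂ) {f : ℝ → ℂ} (hf : f ∈ CtsT) : c • f ∈ CtsT :=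
  ⟨hf.1.smul c, hf.2.const_smul c⟩

lemma cts_zero : (0 : ℝ → ℂ) ∈ CtsT := ⟨fun _ => rfl, continuous_const⟩

lemma coef_zero (n : ℤ) : fourierCoef 0 n = 0 := by
  have := coef_smul 0 0 n
  simpa using this

lemma cts_sum {ι : Type} (s : Finset ι) (f : ι → ℝ → ℂ) (hf : ∀ i, f i ∈ CtsT) :
    (∑ i ∈ s, f i) ∈ CtsT ∧ ∀ m, fourierCoef (∑ i ∈ s, f i) m = ∑ i ∈ s, fourierCoef (f i) m := by
  classical
  induction s using Finset.induction_on with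
  | empty => exact ⟨by simpa using cts_zero, fun m => by simpa using coef_zero m⟩
  | insert a s ha ih =>
    rw [Finset.sum_insert ha]
    refine ⟨cts_add (hf a) ih.1, fun m => ?_⟩
    rw [Finset.sum_insert ha, coef_add (cts_linf (hf a)) (cts_linf ih.1), ih.2]

def Vop (N : ℕ) (g : ℝ → ℂ) : ℝ → ℂ :=
  (1 / (N : ℂ)) • ∑ a ∈ Finset.range N, ∑ b ∈ Finset.range (2 * N),
    fourierCoef g ((a : ℤ) - b) • ex ((a : ℤ) - b)

lemma Vop_cts (N : ℕ) (g : ℝ → ℂ) : Vop N g ∈ CtsT :=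
  cts_smul _ (cts_sum _ _ fun _ => (cts_sum _ _ fun _ => cts_smul _ (ex_cts _)).1).1

lemma Vop_coef (N : ℕ) (g : ℝ → ℂ) (m : ℤ) :
    fourierCoef (Vop N g) m = (1 / (N : ℂ)) * ∑ a ∈ Finset.range N, ∑ b ∈ Finset.range (2 * N),
      if m = (a : ℤ) - b then fourierCoef g m else 0 := by
  rw [Vop, coef_smul, (cts_sum _ _ fun _ => (cts_sum _ _ fun _ => cts_smul _ (ex_cts _)).1).2]
  congr 1
  refine Finset.sum_congr rfl fun a _ => ?_
  rw [(cts_sum _ _ fun _ => cts_smul _ (ex_cts _)).2]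
  refine Finset.sum_congr rfl fun b _ => ?_
  rw [coef_smul, coef_ex]
  split_ifs with h
  · rw [h, mul_one]
  · rw [mul_zero]

lemma Vop_coef_eq {N : ℕ} (g : ℝ → ℂ) {m : ℤ} (h0 : m < 0)
    (h : ∀ m : ℤ, m < -N → fourierCoef g m = 0) (hN : 0 < N) :
    fourierCoef (Vop N g) m = fourierCoef g m := by
  rw [Vop_coef]
  by_cases hm : m < -N
  · rw [h m hm]; simp
  · push Not at hm
    have h1 : ∀ a ∈ Finset.range N, (∑ b ∈ Finset.range (2 * N),
        if m = (a : ℤ) - b then fourierCoef g m else 0) = fourierCoef g m := by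
      intro a ha
      rw [Finset.mem_range] at ha
      rw [Finset.sum_eq_single ((a : ℤ) - m).toNat]
      · rw [if_pos (by omega)]
      · intro b _ hb
        rw [if_neg (by omega)]
      · intro hb
        rw [Finset.mem_range] at hb
        omega
    rw [Finset.sum_congr rfl h1, Finset.sum_const, Finset.card_range, nsmul_eq_mul]
    have : (N : ℂ) ≠ 0 := by exact_mod_cast hN.ne'
    field_simp

def Dk (N : ℕ) (x : ℝ) : ℂ := ∑ a ∈ Finset.range N, ex (a : ℤ) x

lemma Dk_cont (N : ℕ) : Continuous (Dk N) := by
  unfold Dk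
  exact continuous_finsetSum _ fun a _ => (ex_cts _).2

lemma Dk_mul (M N : ℕ) (x : ℝ) : Dk M x * (starRingEnd ℂ) (Dk N x) =
    ∑ a ∈ Finset.range M, ∑ b ∈ Finset.range N, ex ((a : ℤ) - b) x := by
  rw [Dk, Dk, map_sum, Finset.sum_mul_sum]
  refine Finset.sum_congr rfl fun a _ => Finset.sum_congr rfl fun b _ => ?_
  rw [ex_conj, ← ex_add]; rfl

lemma int_mul_Dk {g : ℝ → ℂ} (hg : g ∈ LinfT) (M N : ℕ) (x : ℝ) :
    (1 / (2 * π)) * ∫ y in (0 : ℝ)..(2 * π), g y * (Dk M (x - y) * (starRingEnd ℂ) (Dk N (x - y)))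
      = ∑ a ∈ Finset.range M, ∑ b ∈ Finset.range N,
        fourierCoef g ((a : ℤ) - b) * ex ((a : ℤ) - b) x := by
  have h1 : ∀ y, g y * (Dk M (x - y) * (starRingEnd ℂ) (Dk N (x - y))) =
      ∑ a ∈ Finset.range M, ∑ b ∈ Finset.range N,
        ex ((a : ℤ) - b) x * (g * ex (-((a : ℤ) - b))) y := by
    intro y
    rw [Dk_mul, Finset.mul_sum]
    refine Finset.sum_congr rfl fun a _ => ?_
    rw [Finset.mul_sum]
    refine Finset.sum_congr rfl fun b _ => ?_
    rw [ex_sub_arg, Pi.mul_apply]; ring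
  have h2 : ∀ k : ℤ, IntervalIntegrable (fun y => ex k x * (g * ex (-k)) y) volume 0 (2 * π) :=
    fun k => (linf_ii (linf_mul hg (cts_linf (ex_cts _))) _ _).const_mul _
  simp_rw [h1]
  rw [intervalIntegral.integral_finsetSum, Finset.mul_sum]
  · refine Finset.sum_congr rfl fun a _ => ?_
    rw [intervalIntegral.integral_finsetSum, Finset.mul_sum]
    · refine Finset.sum_congr rfl fun b _ => ?_
      rw [intervalIntegral.integral_const_mul, coef_def]; ring
    · intro b _; exact h2 _
  · intro a _
    have := IntervalIntegrable.sum (Finset.range N) (f := fun (b : ℕ) y =>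
      ex ((a : ℤ) - b) x * (g * ex (-((a : ℤ) - b))) y) (μ := volume) (a := 0) (b := 2 * π)
      fun b _ => h2 _
    have e : (∑ b ∈ Finset.range N, fun y => ex ((a : ℤ) - b) x * (g * ex (-((a : ℤ) - b))) y) =
        fun y => ∑ b ∈ Finset.range N, ex ((a : ℤ) - b) x * (g * ex (-((a : ℤ) - b))) y := by
      funext y
      rw [Finset.sum_apply]
    rw [e] at this
    exact this

lemma int_Dk_sq (N : ℕ) (x : ℝ) : ∫ y in (0 : ℝ)..(2 * π), ‖Dk N (x - y)‖ ^ 2 = 2 * π * N := by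
  have h := int_mul_Dk (cts_linf one_cts) N N x
  have h1 : ∀ k : ℤ, fourierCoef 1 k = if k = 0 then 1 else 0 := by
    intro k
    rw [← coef_ex 0 k]
    congr 1
    funext y; simp [ex]
  have h2 : (∑ a ∈ Finset.range N, ∑ b ∈ Finset.range N,
        fourierCoef 1 ((a : ℤ) - b) * ex ((a : ℤ) - b) x) = N := by
    have : ∀ a ∈ Finset.range N, (∑ b ∈ Finset.range N,
        fourierCoef 1 ((a : ℤ) - b) * ex ((a : ℤ) - b) x) = 1 := by
      intro a ha
      rw [Finset.sum_eq_single a]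
      · simp [h1, ex]
      · intro b _ hb
        rw [h1, if_neg (by omega), zero_mul]
      · intro h; exact absurd ha h
    rw [Finset.sum_congr rfl this]; simp
  rw [h2] at h
  have h3 : ∀ y, (1 : ℝ → ℂ) y * (Dk N (x - y) * (starRingEnd ℂ) (Dk N (x - y))) =
      ((‖Dk N (x - y)‖ ^ 2 : ℝ) : ℂ) := by
    intro y
    rw [Complex.mul_conj, Complex.normSq_eq_norm_sq]; simp
  simp_rw [h3] at h
  rw [intervalIntegral.integral_ofReal] at h
  have h4 : ((∫ y in (0 : ℝ)..(2 * π), ‖Dk N (x - y)‖ ^ 2 : ℝ) : ℂ) = ((2 * π * N : ℝ) : ℂ) := by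
    have : (π : ℂ) ≠ 0 := by exact_mod_cast Real.pi_ne_zero
    field_simp at h
    rw [h]; push_cast; ring
  exact_mod_cast h4

lemma Vop_bound {N : ℕ} (hN : 0 < N) {g : ℝ → ℂ} (hg : g ∈ LinfT) {C : ℝ}
    (hC : ∀ x, ‖g x‖ ≤ C) (x : ℝ) : ‖Vop N g x‖ ≤ 2 * C := by
  have hC0 : 0 ≤ C := (norm_nonneg _).trans (hC 0)
  have e : Vop N g x = (1 / (N : ℂ)) * ((1 / (2 * π)) * ∫ y in (0 : ℝ)..(2 * π),
      g y * (Dk N (x - y) * (starRingEnd ℂ) (Dk (2 * N) (x - y)))) := by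
    rw [int_mul_Dk hg]
    simp [Vop, Finset.sum_apply]
  have hc : ∀ M, Continuous fun y => ‖Dk M (x - y)‖ ^ 2 := fun M =>
    (((Dk_cont M).comp (continuous_const.sub continuous_id)).norm).pow 2
  have b1 : ‖∫ y in (0 : ℝ)..(2 * π), g y * (Dk N (x - y) * (starRingEnd ℂ) (Dk (2 * N) (x - y)))‖
      ≤ ∫ y in (0 : ℝ)..(2 * π), (C / 2) * (‖Dk N (x - y)‖ ^ 2 + ‖Dk (2 * N) (x - y)‖ ^ 2) := by
    apply intervalIntegral.norm_integral_le_of_norm_le Real.two_pi_pos.le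
    · refine Eventually.of_forall fun y _ => ?_
      rw [norm_mul, norm_mul, RCLike.norm_conj]
      have h1 := two_mul_le_add_sq (‖Dk N (x - y)‖) (‖Dk (2 * N) (x - y)‖)
      have h2 : ‖g y‖ * (‖Dk N (x - y)‖ * ‖Dk (2 * N) (x - y)‖) ≤
        C * (‖Dk N (x - y)‖ * ‖Dk (2 * N) (x - y)‖) := by
        gcongr; exact hC y
      nlinarith
    · exact (continuous_const.mul ((hc _).add (hc _))).intervalIntegrable _ _
  rw [intervalIntegral.integral_const_mul, intervalIntegral.integral_add
    ((hc _).intervalIntegrable _ _) ((hc _).intervalIntegrable _ _), int_Dk_sq, int_Dk_sq] at b1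
  have h2 : ‖(1 / (2 * π) : ℂ)‖ = 1 / (2 * π) := by
    rw [show (1 / (2 * π) : ℂ) = ((1 / (2 * π) : ℝ) : ℂ) by push_cast; rfl, Complex.norm_real,
      Real.norm_of_nonneg (by positivity)]
  have h3 : ‖(1 / (N : ℂ))‖ = 1 / N := by simp
  have hN' : (0 : ℝ) < N := by exact_mod_cast hN
  rw [e, norm_mul, norm_mul, h2, h3]
  calc _ ≤ 1 / (N : ℝ) * (1 / (2 * π) * (C / 2 * (2 * π * N + 2 * π * ((2 * N : ℕ) : ℝ)))) := by
        gcongr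
    _ = 3 / 2 * C := by push_cast; field_simp; ring
    _ ≤ 2 * C := by linarith

/-! ### The algebra `C + H^∞` as a uniform closure -/

/-- Bounded functions with finitely many nonzero negative Fourier coefficients. -/
def PolyA : Set (ℝ → ℂ) := {f ∈ LinfT | ∃ N : ℕ, ∀ m : ℤ, m < -N → fourierCoef f m = 0}

/-- The uniform closure of `PolyA`. -/
def closP : Set (ℝ → ℂ) :=
  {f ∈ LinfT | ∀ ε : ℝ, 0 < ε → ∃ g ∈ PolyA, ∀ x, ‖f x - g x‖ ≤ ε}

lemma poly_add {f g : ℝ → ℂ} (hf : f ∈ PolyA) (hg : g ∈ PolyA) : f + g ∈ PolyA := by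
  obtain ⟨h1, N, hN⟩ := hf
  obtain ⟨h2, M, hM⟩ := hg
  refine ⟨linf_add h1 h2, N + M, fun m hm => ?_⟩
  push_cast at hm
  rw [coef_add h1 h2, hN m (by omega), hM m (by omega), add_zero]

lemma poly_smul (c : ℂ) {f : ℝ → ℂ} (hf : f ∈ PolyA) : c • f ∈ PolyA := by
  obtain ⟨h1, N, hN⟩ := hf
  exact ⟨linf_smul c h1, N, fun m hm => by rw [coef_smul, hN m hm, mul_zero]⟩

lemma poly_sub {f g : ℝ → ℂ} (hf : f ∈ PolyA) (hg : g ∈ PolyA) : f - g ∈ PolyA := by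
  have := poly_add hf (poly_smul (-1) hg)
  simpa [sub_eq_add_neg] using this

lemma poly_mul {f g : ℝ → ℂ} (hf : f ∈ PolyA) (hg : g ∈ PolyA) : f * g ∈ PolyA := by
  obtain ⟨h1, N, hN⟩ := hf
  obtain ⟨h2, M, hM⟩ := hg
  refine ⟨linf_mul h1 h2, N + M, fun m hm => coef_mul_zero h1 h2 m fun k => ?_⟩
  push_cast at hm
  by_cases hk : k < -M
  · rw [hM k hk, mul_zero]
  · rw [hN (m - k) (by omega), zero_mul]

lemma poly_ex (k : ℤ) : ex k ∈ PolyA := by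
  refine ⟨cts_linf (ex_cts k), k.natAbs, fun m hm => ?_⟩
  rw [coef_ex, if_neg (by omega)]

lemma poly_V {g : ℝ → ℂ} (hg : g ∈ PolyA) {C : ℝ} (hC : ∀ x, ‖g x‖ ≤ C) :
    ∃ t ∈ CtsT, (∀ x, ‖t x‖ ≤ 2 * C) ∧ ∀ m : ℤ, m < 0 → fourierCoef t m = fourierCoef g m := by
  obtain ⟨h1, N, hN⟩ := hg
  exact ⟨Vop (N + 1) g, Vop_cts _ _, Vop_bound (Nat.succ_pos N) h1 hC, fun m hm =>
    Vop_coef_eq g hm (fun m hm => hN m (by push_cast at hm; omega)) (Nat.succ_pos N)⟩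

lemma closP_split {f : ℝ → ℂ} (hf : f ∈ closP) : ∃ c ∈ CtsT, ∃ h ∈ HinfT, f = c + h := by
  obtain ⟨hL, happ⟩ := hf
  choose g hg hfg using fun n : ℕ => happ ((1 / 2) ^ n) (by positivity)
  have hd : ∀ n x, ‖(g (n + 1) - g n) x‖ ≤ 2 * (1 / 2) ^ n := by
    intro n x
    have h1 := hfg n x
    have h2 := hfg (n + 1) x
    have h3 : (g (n + 1) - g n) x = (f x - g n x) - (f x - g (n + 1) x) := by
      simp only [Pi.sub_apply]; ring
    rw [h3]
    refine (norm_sub_le _ _).trans ?_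
    have : ((1 : ℝ) / 2) ^ (n + 1) ≤ (1 / 2) ^ n := by
      rw [pow_succ]
      have : (0 : ℝ) ≤ (1 / 2) ^ n := by positivity
      linarith
    linarith
  choose t ht htb htc using fun n => poly_V (poly_sub (hg (n + 1)) (hg n)) (hd n)
  obtain ⟨C0, hC0⟩ := (hg 0).1.2.2
  obtain ⟨t0, ht0, -, ht0c⟩ := poly_V (hg 0) hC0
  let S : ℕ → ℝ → ℂ := fun n => t0 + ∑ i ∈ Finset.range n, t i
  have hS : ∀ n, S n ∈ CtsT := fun n => cts_add ht0 (cts_sum _ _ ht).1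
  have hSc : ∀ n (m : ℤ), m < 0 → fourierCoef (S n) m = fourierCoef (g n) m := by
    intro n m hm
    induction n with
    | zero => simpa [S] using ht0c m hm
    | succ n ih =>
      have : S (n + 1) = S n + t n := by simp only [S, Finset.sum_range_succ, add_assoc]
      rw [this, coef_add (cts_linf (hS n)) (cts_linf (ht n)), ih, htc n m hm,
        coef_sub (hg (n + 1)).1 (hg n).1]
      ring
  have hsum : Summable fun n : ℕ => 2 * (2 * ((1 : ℝ) / 2) ^ n) :=
    ((summable_geometric_of_lt_one (by norm_num) (by norm_num)).mul_left 2).mul_left 2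
  let c : ℝ → ℂ := fun x => t0 x + ∑' n, t n x
  have hc : c ∈ CtsT := by
    refine ⟨fun x => ?_, ht0.2.add (continuous_tsum (fun n => (ht n).2) hsum htb)⟩
    simp only [c, ht0.1 x, fun n => (ht n).1 x]
  have hSlim : ∀ x, Tendsto (fun n => S n x) atTop (𝓝 (c x)) := by
    intro x
    have : Summable fun n => t n x := Summable.of_norm_bounded hsum fun n => htb n x
    have := (this.hasSum.tendsto_sum_nat).const_add (t0 x)
    simpa [S, c] using this
  have hSb : ∀ n x, ‖(S n - c) x‖ ≤ 8 * (1 / 2) ^ n := by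
    intro n x
    have h1 := dist_le_of_le_geometric_of_tendsto (1 / 2 : ℝ) 4 (by norm_num)
      (f := fun n => S n x) (fun n => ?_) (hSlim x) n
    · rw [dist_eq_norm] at h1
      have h2 : 4 * (1 / 2 : ℝ) ^ n / (1 - 1 / 2) = 8 * (1 / 2) ^ n := by ring
      rw [h2] at h1
      exact h1
    · have h2 : S (n + 1) x = S n x + t n x := by
        simp only [S, Finset.sum_range_succ, Pi.add_apply, add_assoc]
      rw [h2, dist_eq_norm]
      have := htb n x
      simp only [sub_add_cancel_left, norm_neg]
      linarith
  refine ⟨c, hc, f - c, ⟨linf_sub hL (cts_linf hc), fun m hm => ?_⟩, by simp⟩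
  have key : ∀ n : ℕ, ‖fourierCoef (f - c) m‖ ≤ 9 * (1 / 2) ^ n := by
    intro n
    have e1 : fourierCoef (f - c) m = fourierCoef (f - g n) m + fourierCoef (S n - c) m := by
      rw [coef_sub hL (cts_linf hc), coef_sub hL (hg n).1, coef_sub (cts_linf (hS n)) (cts_linf hc),
        hSc n m hm]
      ring
    rw [e1]
    have b1 := coef_norm_le (f := f - g n) (hfg n) m
    have b2 := coef_norm_le (hSb n) m
    refine (norm_add_le _ _).trans ?_
    linarith
  have lim : Tendsto (fun n : ℕ => 9 * ((1 : ℝ) / 2) ^ n) atTop (𝓝 (9 * 0)) :=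
    (tendsto_pow_atTop_nhds_zero_of_lt_one (by norm_num) (by norm_num)).const_mul 9
  have := ge_of_tendsto' lim key
  rw [mul_zero] at this
  exact norm_le_zero_iff.1 this

lemma cts_approx {c : ℝ → ℂ} (hc : c ∈ CtsT) {ε : ℝ} (hε : 0 < ε) :
    ∃ g ∈ PolyA, ∀ x, ‖c x - g x‖ ≤ ε := by
  let cl : C(AddCircle (2 * π), ℂ) := ⟨hc.1.lift, hc.2.quotient_lift _⟩
  have hmem : cl ∈ (Submodule.span ℂ (Set.range (@fourier (2 * π)))).topologicalClosure := by
    rw [span_fourier_closure_eq_top]; trivial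
  obtain ⟨p, hp, hd⟩ := Metric.mem_closure_iff.1 hmem ε hε
  refine ⟨fun x => p (x : AddCircle (2 * π)), ?_, fun x => ?_⟩
  · clear hd
    induction hp using Submodule.span_induction with
    | mem p h =>
      obtain ⟨k, rfl⟩ := h
      have := poly_ex k
      rwa [show ex k = fun x : ℝ => fourier k (x : AddCircle (2 * π)) from
        funext (ex_eq_fourier k)] at this
    | zero =>
      have := poly_smul 0 (poly_ex 0)
      rwa [zero_smul] at this
    | add p q _ _ h1 h2 => exact poly_add h1 h2
    | smul a p _ h => exact poly_smul a h
  · rw [dist_eq_norm] at hd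
    have h1 := (cl - p).norm_coe_le_norm (x : AddCircle (2 * π))
    have h2 : (cl - p) (x : AddCircle (2 * π)) = c x - p (x : AddCircle (2 * π)) := by
      have := hc.1.lift_coe x
      exact congrArg (· - p (x : AddCircle (2 * π))) this
    rw [h2] at h1
    linarith

lemma closP_of_split {c h : ℝ → ℂ} (hc : c ∈ CtsT) (hh : h ∈ HinfT) : c + h ∈ closP := by
  refine ⟨linf_add (cts_linf hc) hh.1, fun ε hε => ?_⟩
  obtain ⟨g, hg, hb⟩ := cts_approx hc hε
  refine ⟨g + h, poly_add hg ⟨hh.1, 0, fun m hm => hh.2 m (by simpa using hm)⟩, fun x => ?_⟩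
  simpa using hb x

lemma closP_add {f g : ℝ → ℂ} (hf : f ∈ closP) (hg : g ∈ closP) : f + g ∈ closP := by
  refine ⟨linf_add hf.1 hg.1, fun ε hε => ?_⟩
  obtain ⟨p, hp, h1⟩ := hf.2 (ε / 2) (by positivity)
  obtain ⟨q, hq, h2⟩ := hg.2 (ε / 2) (by positivity)
  refine ⟨p + q, poly_add hp hq, fun x => ?_⟩
  have : (f + g) x - (p + q) x = (f x - p x) + (g x - q x) := by
    simp only [Pi.add_apply]; ring
  rw [this]
  refine (norm_add_le _ _).trans ?_
  linarith [h1 x, h2 x]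

lemma closP_mul {f g : ℝ → ℂ} (hf : f ∈ closP) (hg : g ∈ closP) : f * g ∈ closP := by
  refine ⟨linf_mul hf.1 hg.1, fun ε hε => ?_⟩
  obtain ⟨C, hC⟩ := hg.1.2.2
  have hC0 : 0 ≤ C := (norm_nonneg _).trans (hC 0)
  obtain ⟨p, hp, h1⟩ := hf.2 (ε / (2 * (C + 1))) (by positivity)
  obtain ⟨B, hB⟩ := hp.1.2.2
  have hB0 : 0 ≤ B := (norm_nonneg _).trans (hB 0)
  obtain ⟨q, hq, h2⟩ := hg.2 (ε / (2 * (B + 1))) (by positivity)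
  refine ⟨p * q, poly_mul hp hq, fun x => ?_⟩
  have : (f * g) x - (p * q) x = (f x - p x) * g x + p x * (g x - q x) := by
    simp only [Pi.mul_apply]; ring
  rw [this]
  refine (norm_add_le _ _).trans ?_
  rw [norm_mul, norm_mul]
  have a1 : ‖f x - p x‖ * ‖g x‖ ≤ ε / (2 * (C + 1)) * (C + 1) :=
    mul_le_mul (h1 x) ((hC x).trans (by linarith)) (norm_nonneg _) (by positivity)
  have a2 : ‖p x‖ * ‖g x - q x‖ ≤ (B + 1) * (ε / (2 * (B + 1))) :=
    mul_le_mul ((hB x).trans (by linarith)) (h2 x) (norm_nonneg _) (by positivity)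
  have a3 : ε / (2 * (C + 1)) * (C + 1) = ε / 2 := by field_simp
  have a4 : (B + 1) * (ε / (2 * (B + 1))) = ε / 2 := by field_simp
  linarith

lemma hinf_zero : (0 : ℝ → ℂ) ∈ HinfT :=
  ⟨cts_linf cts_zero, fun n _ => coef_zero n⟩

lemma closP_cts {c : ℝ → ℂ} (hc : c ∈ CtsT) : c ∈ closP := by
  simpa using closP_of_split hc hinf_zero

lemma closP_smul (a : ℂ) {f : ℝ → ℂ} (hf : f ∈ closP) : a • f ∈ closP := by
  have := closP_mul (closP_cts (cts_smul a one_cts)) hf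
  simpa using this

lemma flipF_flipF (q : ℝ → ℂ) : flipF (flipF q) = q := by
  funext x; simp [flipF]

lemma qc_iff (f : ℝ → ℂ) : f ∈ QCset ↔ f ∈ closP ∧ flipF f ∈ closP := by
  constructor
  · rintro ⟨⟨c, hc, h, hh, rfl⟩, ⟨c', hc', h', hh', e⟩⟩
    refine ⟨closP_of_split hc hh, ?_⟩
    rw [e]
    have : flipF (c' + h') = flipF c' + flipF h' := rfl
    rw [this]
    refine closP_of_split (flip_cts hc') ⟨linf_flip hh'.1, fun n hn => ?_⟩
    rw [coef_flip hh'.1, hh'.2 _ (by omega)]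
  · rintro ⟨h1, h2⟩
    refine ⟨closP_split h1, ?_⟩
    obtain ⟨c, hc, h, hh, e⟩ := closP_split h2
    refine ⟨flipF c, flip_cts hc, flipF h, ⟨linf_flip hh.1, fun n hn => ?_⟩, ?_⟩
    · rw [coef_flip hh.1, hh.2 _ (by omega)]
    · rw [← flipF_flipF f, e]; rfl

lemma qcAlg : QCAlg where
  add p hp q hq := by
    rw [qc_iff] at *
    exact ⟨closP_add hp.1 hq.1, closP_add hp.2 hq.2⟩
  mul p hp q hq := by
    rw [qc_iff] at *
    exact ⟨closP_mul hp.1 hq.1, closP_mul hp.2 hq.2⟩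
  smul c q hq := by
    rw [qc_iff] at *
    exact ⟨closP_smul c hq.1, closP_smul c hq.2⟩
  flip q hq := by
    rw [qc_iff] at *
    rw [flipF_flipF]
    exact ⟨hq.2, hq.1⟩
  cts q hq := by
    rw [qc_iff]
    exact ⟨closP_cts hq, closP_cts (flip_cts hq)⟩

/-- Let `η ∈ M(Q̃C)` lie in the fiber over `τ = e^{iθ}` with `Im τ > 0` (`0 < θ < π`),
i.e. `η(f) = f(τ)` for even continuous `f`. Then `M^η(QC) = {ξ, ξ'}` for a unique
`ξ ∈ M_τ(QC)`, where `ξ' = conjChar ξ ∈ M_{τ̄}(QC)`. Consequently `Ψ : ξ ↦ ξ|_{Q̃C}`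
restricts to a bijection from `M_τ(QC)` onto `M_τ(Q̃C)`. -/
theorem fiber_over_even_char_upper (θ : ℝ) (hθ : 0 < θ ∧ θ < π)
    (η : (ℝ → ℂ) → ℂ) (hη : IsChar tQCset η)
    (hfib : ∀ f ∈ evContT, η f = f θ) :
    (∃ ξ : (ℝ → ℂ) → ℂ,
      InFiber QCset θ ξ ∧ (∀ q ∈ tQCset, ξ q = η q) ∧
      InFiber QCset (-θ) (conjChar ξ) ∧ (∀ q ∈ tQCset, conjChar ξ q = η q) ∧
      (∀ ζ, IsChar QCset ζ → (∀ q ∈ tQCset, ζ q = η q) →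
        (∀ q ∈ QCset, ζ q = ξ q) ∨ (∀ q ∈ QCset, ζ q = conjChar ξ q)) ∧
      (∀ ξ₂, InFiber QCset θ ξ₂ → (∀ q ∈ tQCset, ξ₂ q = η q) →
        ∀ q ∈ QCset, ξ₂ q = ξ q)) ∧
    (∀ ξ₁ ξ₂, InFiber QCset θ ξ₁ → InFiber QCset θ ξ₂ →
      (∀ q ∈ tQCset, ξ₁ q = ξ₂ q) → ∀ q ∈ QCset, ξ₁ q = ξ₂ q) ∧
    (∀ η', IsChar tQCset η' → (∀ f ∈ evContT, η' f = f θ) →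
      ∃ ξ, InFiber QCset θ ξ ∧ ∀ q ∈ tQCset, ξ q = η' q) := by
  have A := qcAlg
  have hs : 0 < Real.sin θ := Real.sin_pos_of_pos_of_lt_pi hθ.1 hθ.2
  obtain ⟨h1, h2⟩ := surj_part A hs hη hfib
  refine ⟨⟨extC θ η, h1, h2, ⟨conj_isChar A h1.1, fun f hf => ?_⟩, fun q hq => ?_,
    fiber_part A hs hfib, fun ξ₂ hξ₂ he => ?_⟩, inj_part A hs, fun η' hη' hfib' =>
    ⟨extC θ η', surj_part A hs hη' hfib'⟩⟩
  · exact ext_cts hs hfib (flip_cts hf.1)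
  · simp only [conjChar]
    rw [hq.2, h2 q hq]
  · exact inj_part A hs _ _ hξ₂ h1 fun q hq => (he q hq).trans (h2 q hq).symm
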